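/- Let K be a field of characteristic 0, δ a derivation on K with field of constants F, L/K a field extension to which δ extends with constant field C = Const(δ on L), and suppose L = K·C is a constant extension of K. If f ∈ K[t;δ] is an A-polynomial of degree m, then f, viewed in L[t;δ], is an A-polynomial, and Nuc_r(L[t;δ]/L[t;δ]f) ≅ Nuc_r(K[t;δ]/K[t;δ]f) ⊗_F C. -/

import Mathlib

open scoped TensorProduct

/-! ## A framework for differential polynomial rings `K[t;δ]` and Petit algebras `S_f`. -/

/-- A derivation on a field `K`: an additive map satisfying the Leibniz rule. -/
structure Der (K : Type) [Field K] where
  toFun : K → K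
  map_add' : ∀ a b : K, toFun (a + b) = toFun a + toFun b
  leibniz' : ∀ a b : K, toFun (a * b) = a * toFun b + toFun a * b

/-- `F` (given as a subfield of `K` via `algebraMap F K`) is precisely the field of
constants `Const(δ) = {a ∈ K | δ(a) = 0}` of the derivation `δ`. -/
def Der.HasConstants {K : Type} [Field K] (δ : Der K) (F : Type) [Field F]
    [Algebra F K] : Prop :=
  ∀ a : K, δ.toFun a = 0 ↔ ∃ c : F, algebraMap F K c = a

/-- The map `V_p(b) = b^p + δ^{p-1}(b)`. -/
def Der.Vp {K : Type} [Field K] (δ : Der K) (p : ℕ) (b : K) : K :=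
  b ^ p + δ.toFun^[p - 1] b

/-- The `e`-fold iterate `V_{p^e}` of `V_p`. -/
def Der.VpIter {K : Type} [Field K] (δ : Der K) (p e : ℕ) : K → K :=
  (δ.Vp p)^[e]

/-- A realization of the differential polynomial ring `R = K[t;δ]`: a ring `R`
together with an embedding `i : K → R` and an element `t` satisfying the
twist relation `t·a = a·t + δ(a)`, such that every element of `R` is *uniquely*
a left `K`-linear combination of the powers `t^n` (witnessed by the coefficient
function `coeff`), and such that `R` admits a right division algorithm. -/
structure DiffPolyRing (K : Type) [Field K] (δ : Der K) (R : Type) [Ring R] where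
  i : K →+* R
  t : R
  coeff : R → (ℕ →₀ K)
  t_mul : ∀ a : K, t * i a = i a * t + i (δ.toFun a)
  repr' : ∀ x : R, x = (coeff x).sum fun n a => i a * t ^ n
  coeff_unique : ∀ (x : R) (c : ℕ →₀ K), x = (c.sum fun n a => i a * t ^ n) → c = coeff x
  rightDiv : ∀ f x : R, f ≠ 0 → ∃! r : R,
    (∃ q : R, x = q * f + r) ∧ (coeff r).support.max < (coeff f).support.max

namespace DiffPolyRing

variable {K : Type} [Field K] {δ : Der K} {R : Type} [Ring R]

/-- The degree of a differential polynomial, with `deg 0 = ⊥`. -/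
def deg (D : DiffPolyRing K δ R) (x : R) : WithBot ℕ := (D.coeff x).support.max

lemma coeff_zero (D : DiffPolyRing K δ R) : D.coeff 0 = 0 :=
  (D.coeff_unique 0 0 (by simp)).symm

lemma deg_zero (D : DiffPolyRing K δ R) : D.deg 0 = ⊥ := by
  simp [deg, D.coeff_zero]

lemma coeff_add (D : DiffPolyRing K δ R) (x y : R) :
    D.coeff (x + y) = D.coeff x + D.coeff y := by
  refine (D.coeff_unique _ _ ?_).symm
  rw [Finsupp.sum_add_index' (by simp) (by intro n a b; rw [map_add, add_mul])]
  conv_lhs => rw [D.repr' x, D.repr' y]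

lemma coeff_neg (D : DiffPolyRing K δ R) (x : R) : D.coeff (-x) = -D.coeff x := by
  have h := D.coeff_add (-x) x
  rw [neg_add_cancel, D.coeff_zero] at h
  exact eq_neg_of_add_eq_zero_left h.symm

lemma deg_neg (D : DiffPolyRing K δ R) (x : R) : D.deg (-x) = D.deg x := by
  simp [deg, D.coeff_neg]

lemma deg_add_lt (D : DiffPolyRing K δ R) {x y : R} {n : WithBot ℕ}
    (hx : D.deg x < n) (hy : D.deg y < n) : D.deg (x + y) < n := by
  have hsub : (D.coeff (x + y)).support ⊆ (D.coeff x).support ∪ (D.coeff y).support := by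
    rw [D.coeff_add]; exact Finsupp.support_add
  calc D.deg (x + y) ≤ ((D.coeff x).support ∪ (D.coeff y).support).max :=
        Finset.max_mono hsub
    _ = max (D.deg x) (D.deg y) := Finset.max_union
    _ < n := max_lt hx hy

lemma coeff_smul (D : DiffPolyRing K δ R) (c : K) (x : R) :
    D.coeff (D.i c * x) = c • D.coeff x := by
  refine (D.coeff_unique _ _ ?_).symm
  rw [Finsupp.sum_smul_index (by simp)]
  conv_lhs => rw [D.repr' x, Finsupp.mul_sum]
  exact Finsupp.sum_congr fun n _ => by rw [← mul_assoc, ← map_mul]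

lemma deg_i_mul_lt (D : DiffPolyRing K δ R) (c : K) {x : R} {n : WithBot ℕ}
    (hx : D.deg x < n) : D.deg (D.i c * x) < n := by
  have hsub : (D.coeff (D.i c * x)).support ⊆ (D.coeff x).support := by
    rw [D.coeff_smul]; exact Finsupp.support_smul
  exact lt_of_le_of_lt (Finset.max_mono hsub) hx

/-- The additive subgroup of `R` consisting of the differential polynomials of
degree `< m`; this is the underlying set of the Petit algebra `S_f` for `deg f = m`. -/
def res (D : DiffPolyRing K δ R) (m : ℕ) : AddSubgroup R where
  carrier := {x | D.deg x < (m : WithBot ℕ)}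
  add_mem' hx hy := D.deg_add_lt hx hy
  zero_mem' := by
    show D.deg 0 < (m : WithBot ℕ)
    rw [D.deg_zero]
    exact bot_lt_iff_ne_bot.2 (by simp)
  neg_mem' {x} hx := by
    show D.deg (-x) < (m : WithBot ℕ)
    rw [D.deg_neg]; exact hx

/-- The underlying set `{g ∈ K[t;δ] | deg g < m}` of the Petit algebra `S_f`
(for `f` of degree `m`), viewed as a subset of `R = K[t;δ]`. -/
def SfSet (D : DiffPolyRing K δ R) (m : ℕ) : Set R := {x | D.deg x < (m : WithBot ℕ)}

/-- The underlying `F`-vector space of the Petit algebra `S_f`, for `f` of degree `m`. -/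
abbrev Rlt (D : DiffPolyRing K δ R) (m : ℕ) : Type := ↥(D.res m)

instance instSMul {F : Type} [Field F] [Algebra F K] (D : DiffPolyRing K δ R) (m : ℕ) :
    SMul F (D.Rlt m) :=
  ⟨fun c x => ⟨D.i (algebraMap F K c) * (x : R), D.deg_i_mul_lt _ x.2⟩⟩

lemma smul_coe {F : Type} [Field F] [Algebra F K] (D : DiffPolyRing K δ R) (m : ℕ)
    (c : F) (x : D.Rlt m) : ((c • x : D.Rlt m) : R) = D.i (algebraMap F K c) * (x : R) := rfl

/-- The `F`-vector space structure of the Petit algebra (where `F ⊆ K` is the field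
of constants): `c • x = i(c)·x`. -/
instance instModule {F : Type} [Field F] [Algebra F K] (D : DiffPolyRing K δ R) (m : ℕ) :
    Module F (D.Rlt m) where
  one_smul x := Subtype.ext <| by rw [smul_coe]; simp
  mul_smul a b x := Subtype.ext <| by rw [smul_coe, smul_coe, smul_coe]; simp [mul_assoc]
  smul_zero a := Subtype.ext <| by rw [smul_coe]; simp
  smul_add a x y := Subtype.ext <| by
    rw [smul_coe]
    push_cast
    rw [smul_coe, smul_coe, mul_add]
  add_smul a b x := Subtype.ext <| by
    push_cast
    rw [smul_coe, smul_coe, smul_coe]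
    simp [add_mul]
  zero_smul x := Subtype.ext <| by rw [smul_coe]; simp

open Classical in
/-- The remainder `mod_r f` of right division by `f`. -/
noncomputable def modr (D : DiffPolyRing K δ R) (f x : R) : R :=
  if h : ∃! r : R, (∃ q : R, x = q * f + r) ∧
      (D.coeff r).support.max < (D.coeff f).support.max then h.choose else 0

/-- The multiplication of the Petit algebra `S_f`: `g ∘ h = g·h mod_r f`. -/
noncomputable def pmul (D : DiffPolyRing K δ R) (f x y : R) : R := D.modr f (x * y)

/-- The left nucleus of the Petit algebra `S_f`, as a subset of `R`. -/
def nucl (D : DiffPolyRing K δ R) (f : R) (m : ℕ) : Set R :=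
  {x ∈ D.SfSet m | ∀ y ∈ D.SfSet m, ∀ z ∈ D.SfSet m,
    D.pmul f (D.pmul f x y) z = D.pmul f x (D.pmul f y z)}

/-- The middle nucleus of the Petit algebra `S_f`, as a subset of `R`. -/
def nucm (D : DiffPolyRing K δ R) (f : R) (m : ℕ) : Set R :=
  {x ∈ D.SfSet m | ∀ y ∈ D.SfSet m, ∀ z ∈ D.SfSet m,
    D.pmul f (D.pmul f y x) z = D.pmul f y (D.pmul f x z)}

/-- The right nucleus of the Petit algebra `S_f`, as a subset of `R`. -/
def nucr (D : DiffPolyRing K δ R) (f : R) (m : ℕ) : Set R :=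
  {x ∈ D.SfSet m | ∀ y ∈ D.SfSet m, ∀ z ∈ D.SfSet m,
    D.pmul f (D.pmul f y z) x = D.pmul f y (D.pmul f z x)}

/-- The nucleus of the Petit algebra `S_f`, as a subset of `R`. -/
def nuc (D : DiffPolyRing K δ R) (f : R) (m : ℕ) : Set R :=
  D.nucl f m ∩ D.nucm f m ∩ D.nucr f m

/-- `f` is irreducible in `K[t;δ]`: it is not a unit and admits no factorization
into two factors of strictly smaller degree. -/
def Irred (D : DiffPolyRing K δ R) (f : R) : Prop :=
  ¬IsUnit f ∧ ¬∃ g h : R, f = g * h ∧ D.deg g < D.deg f ∧ D.deg h < D.deg f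

/-- The Petit algebra `S_f` is a division algebra: it is nonzero, and all left and
right multiplications by nonzero elements are bijective. -/
def IsDivisionPetit (D : DiffPolyRing K δ R) (f : R) (m : ℕ) : Prop :=
  (∃ x ∈ D.SfSet m, x ≠ 0) ∧ ∀ a ∈ D.SfSet m, a ≠ 0 →
    Set.BijOn (fun x => D.pmul f a x) (D.SfSet m) (D.SfSet m) ∧
    Set.BijOn (fun x => D.pmul f x a) (D.SfSet m) (D.SfSet m)

/-- The unital `F`-algebra `B` realizes the right nucleus of the Petit algebra `S_f`:
there is a bijection `B ≃ Nuc_r(S_f)` preserving addition, multiplication and the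
`F`-algebra structure. -/
def RightNucPresents (F : Type) [Field F] [Algebra F K] (D : DiffPolyRing K δ R)
    (f : R) (m : ℕ) (B : Type) [Ring B] [Algebra F B] : Prop :=
  ∃ φ : B ≃ (D.nucr f m),
    (∀ x y : B, ((φ (x + y) : R)) = (φ x : R) + (φ y : R)) ∧
    (∀ x y : B, ((φ (x * y) : R)) = D.pmul f (φ x : R) (φ y : R)) ∧
    (∀ c : F, ((φ (algebraMap F B c) : R)) = D.i (algebraMap F K c))

/-- A subset `S` of an `F`-vector space has dimension `d`: it contains `d` linearly
independent vectors whose span contains `S`. -/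
def SetDim (F : Type) [Field F] {M : Type} [AddCommGroup M] [Module F M]
    (S : Set M) (d : ℕ) : Prop :=
  ∃ s : Finset M, ↑s ⊆ S ∧ s.card = d ∧
    LinearIndependent F (fun x : (s : Set M) => (x : M)) ∧
    S ⊆ (Submodule.span F (s : Set M) : Set M)

/-- `f ∈ K[t;δ]` of degree `m` is an `A`-polynomial (over the field of constants `F`),
via Amitsur's characterization: the right nucleus of `S_f` has dimension `m²` over `F`. -/
def IsAPoly (F : Type) [Field F] [Algebra F K] (D : DiffPolyRing K δ R)
    (f : R) (m : ℕ) : Prop :=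
  SetDim F {x : D.Rlt m | (x : R) ∈ D.nucr f m} (m ^ 2)

/-- `f ∈ R = K[t;δ]` is bounded: there is `f* ≠ 0` such that `Rf* = f*R` is the
largest two-sided ideal of `R` contained in `Rf`. -/
def IsBounded (D : DiffPolyRing K δ R) (f : R) : Prop :=
  ∃ fs : R, fs ≠ 0 ∧
    {x : R | ∃ r, x = r * fs} = {x : R | ∃ r, x = fs * r} ∧
    (∀ x : R, (∃ r, x = r * fs) → ∃ r, x = r * f) ∧
    ∀ J : Set R, (0 : R) ∈ J → (∀ a ∈ J, ∀ b ∈ J, a + b ∈ J) →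
      (∀ r : R, ∀ a ∈ J, r * a ∈ J ∧ a * r ∈ J) →
      (∀ x ∈ J, ∃ r, x = r * f) → ∀ x ∈ J, ∃ r, x = r * fs

/-- `S_f` is a free right module of rank `n` over its right nucleus. -/
def FreeRankOverNucr (D : DiffPolyRing K δ R) (f : R) (m n : ℕ) : Prop :=
  ∃ b : Fin n → R, (∀ j, b j ∈ D.SfSet m) ∧
    ∀ x ∈ D.SfSet m, ∃! c : Fin n → (D.nucr f m),
      x = ∑ j, D.pmul f (b j) ((c j : R))

/-- The Petit algebra `S_f` is unital with unit `1 ∈ K[t;δ]`. -/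
def PetitUnital (D : DiffPolyRing K δ R) (f : R) (m : ℕ) : Prop :=
  (1 : R) ∈ D.SfSet m ∧ ∀ x ∈ D.SfSet m, D.pmul f 1 x = x ∧ D.pmul f x 1 = x

end DiffPolyRing

namespace Der

variable {K : Type} [Field K] (δ : Der K)

lemma toFun_zero : δ.toFun 0 = 0 := by
  simpa using δ.map_add' 0 0

lemma toFun_one : δ.toFun 1 = 0 := by
  simpa using δ.leibniz' 1 1

/-- If relations between the vectors `w k` may be differentiated, then linear independence
over the constants implies linear independence over the whole field. -/
lemma linearIndependent_of_constants {W ι : Type} [AddCommGroup W] [Module K W] [Fintype ι]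
    (w : ι → W)
    (hδ : ∀ l : ι → K, ∑ k, l k • w k = 0 → ∑ k, δ.toFun (l k) • w k = 0)
    (hc : ∀ l : ι → K, (∀ k, δ.toFun (l k) = 0) → ∑ k, l k • w k = 0 → ∀ k, l k = 0) :
    LinearIndependent K w := by
  classical
  have key : ∀ (n : ℕ) (l : ι → K), (Finset.univ.filter fun k => l k ≠ 0).card = n →
      ∑ k, l k • w k = 0 → ∀ k, l k = 0 := by
    intro n
    induction n using Nat.strong_induction_on with
    | _ n ih =>
      intro l hn hl k₀
      by_contra hk₀
      have hrel : ∑ k, ((l k₀)⁻¹ * l k) • w k = 0 := by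
        simp only [mul_smul, ← Finset.smul_sum, hl, smul_zero]
      have hlt : (Finset.univ.filter fun k => δ.toFun ((l k₀)⁻¹ * l k) ≠ 0).card < n := by
        rw [← hn]
        refine Finset.card_lt_card (Finset.ssubset_iff_of_subset ?_ |>.2 ⟨k₀, by simpa, ?_⟩)
        · intro k hk
          simp only [Finset.mem_filter, Finset.mem_univ, true_and] at hk ⊢
          intro h
          exact hk (by rw [h, mul_zero, toFun_zero])
        · simp [inv_mul_cancel₀ hk₀, toFun_one]
      have hconst := ih _ hlt _ rfl (hδ _ hrel)
      have := hc _ hconst hrel k₀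
      rw [inv_mul_cancel₀ hk₀] at this
      exact one_ne_zero this
  exact Fintype.linearIndependent_iff.2 fun l hl => key _ l rfl hl

end Der

namespace DiffPolyRing

variable {K : Type} [Field K] {δ : Der K} {R : Type} [Ring R]

section Division

variable (D : DiffPolyRing K δ R)

lemma ne_zero_of_deg_eq {f : R} {m : ℕ} (hdeg : D.deg f = (m : WithBot ℕ)) : f ≠ 0 := by
  rintro rfl
  simp [D.deg_zero] at hdeg

lemma exists_eq_mul_add_modr {f : R} (hf : f ≠ 0) (x : R) : ∃ q, x = q * f + D.modr f x := by
  unfold modr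
  rw [dif_pos (D.rightDiv f x hf)]
  exact (D.rightDiv f x hf).choose_spec.1.1

lemma deg_modr_lt {f : R} (hf : f ≠ 0) (x : R) : D.deg (D.modr f x) < D.deg f := by
  unfold modr
  rw [dif_pos (D.rightDiv f x hf)]
  exact (D.rightDiv f x hf).choose_spec.1.2

lemma modr_eq {f : R} (hf : f ≠ 0) {x r : R} (h : ∃ q, x = q * f + r)
    (hr : D.deg r < D.deg f) : D.modr f x = r :=
  (D.rightDiv f x hf).unique ⟨D.exists_eq_mul_add_modr hf x, D.deg_modr_lt hf x⟩ ⟨h, hr⟩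

lemma modr_eq_self {f : R} (hf : f ≠ 0) {x : R} (hx : D.deg x < D.deg f) : D.modr f x = x :=
  D.modr_eq hf ⟨0, by simp⟩ hx

lemma coeff_monomial (c : K) (n : ℕ) : D.coeff (D.i c * D.t ^ n) = Finsupp.single n c :=
  (D.coeff_unique _ _ (by rw [Finsupp.sum_single_index]; simp)).symm

/-- The coefficient function as an additive homomorphism. -/
def coeffHom : R →+ (ℕ →₀ K) where
  toFun := D.coeff
  map_zero' := D.coeff_zero
  map_add' := D.coeff_add

lemma coeff_sum {ι : Type} (s : Finset ι) (x : ι → R) :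
    D.coeff (∑ k ∈ s, x k) = ∑ k ∈ s, D.coeff (x k) :=
  map_sum D.coeffHom x s

lemma deg_lt_iff {x : R} {m : ℕ} :
    D.deg x < (m : WithBot ℕ) ↔ ∀ n, m ≤ n → D.coeff x n = 0 := by
  unfold deg
  rw [Finset.max_eq_sup_withBot, Finset.sup_lt_iff (by exact WithBot.bot_lt_coe m)]
  constructor
  · intro h n hn
    by_contra hne
    have := h n (Finsupp.mem_support_iff.2 hne)
    rw [Nat.cast_withBot, WithBot.coe_lt_coe] at this
    omega
  · intro h n hn
    rw [Nat.cast_withBot, WithBot.coe_lt_coe]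
    by_contra hle
    exact Finsupp.mem_support_iff.1 hn (h n (by omega))

lemma coeff_ne_zero_of_deg_eq {f : R} {m : ℕ} (hdeg : D.deg f = (m : WithBot ℕ)) :
    D.coeff f m ≠ 0 :=
  Finsupp.mem_support_iff.1 (Finset.mem_of_max hdeg)

lemma deg_sub_leading_lt {f : R} {m : ℕ} (hdeg : D.deg f = (m : WithBot ℕ)) :
    D.deg (D.i (D.coeff f m) * D.t ^ m - f) < (m : WithBot ℕ) := by
  rw [D.deg_lt_iff]
  intro n hn
  rw [sub_eq_add_neg, D.coeff_add, D.coeff_neg, D.coeff_monomial]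
  rcases hn.eq_or_lt with rfl | hlt
  · simp
  · have h : D.coeff f n = 0 := by
      by_contra hne
      have := Finset.le_max (Finsupp.mem_support_iff.2 hne)
      rw [show (D.coeff f).support.max = (m : WithBot ℕ) from hdeg, Nat.cast_withBot,
        WithBot.coe_le_coe] at this
      omega
    simp [h, hlt.ne]

/-- An element of degree `< m` lies in the right nucleus of `S_f` exactly when it lies in the
eigenring of `f`. -/
lemma mem_nucr_iff {f : R} {m : ℕ} (hm : 2 ≤ m) (hdeg : D.deg f = (m : WithBot ℕ)) {x : R} :
    x ∈ D.nucr f m ↔ D.deg x < (m : WithBot ℕ) ∧ ∃ q, f * x = q * f := by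
  have hf := D.ne_zero_of_deg_eq hdeg
  refine and_congr_right fun hx => ⟨fun h => ?_, ?_⟩
  · have hy : D.deg (D.i (D.coeff f m) * D.t ^ (m - 1)) < (m : WithBot ℕ) := by
      rw [D.deg_lt_iff]
      intro n hn
      rw [D.coeff_monomial, Finsupp.single_apply, if_neg (by omega)]
    have ht : D.deg D.t < (m : WithBot ℕ) := by
      rw [D.deg_lt_iff]
      intro n hn
      have := D.coeff_monomial 1 1
      rw [map_one, one_mul, pow_one] at this
      rw [this, Finsupp.single_apply, if_neg (by omega)]
    have key := h _ hy _ ht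
    set a := D.i (D.coeff f m)
    have hyt : a * D.t ^ (m - 1) * D.t = a * D.t ^ m := by
      rw [mul_assoc, ← pow_succ, Nat.sub_add_cancel (by omega)]
    have h1 : D.pmul f (a * D.t ^ (m - 1)) D.t = a * D.t ^ m - f :=
      D.modr_eq hf ⟨1, by rw [hyt, one_mul, add_sub_cancel]⟩ (hdeg ▸ D.deg_sub_leading_lt hdeg)
    rw [h1] at key
    obtain ⟨q₁, h₁⟩ := D.exists_eq_mul_add_modr hf ((a * D.t ^ m - f) * x)
    obtain ⟨q₂, h₂⟩ := D.exists_eq_mul_add_modr hf (a * D.t ^ (m - 1) * D.pmul f D.t x)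
    obtain ⟨q₃, h₃⟩ := D.exists_eq_mul_add_modr hf (D.t * x)
    change _ = _ + D.pmul f _ _ at h₁ h₂ h₃
    refine ⟨a * D.t ^ (m - 1) * q₃ + q₂ - q₁, ?_⟩
    have h₄ : a * D.t ^ m * x = a * D.t ^ (m - 1) * (D.t * x) := by
      rw [← hyt]; simp only [mul_assoc]
    have h₅ : f * x = a * D.t ^ m * x - (a * D.t ^ m - f) * x := by noncomm_ring
    rw [h₅, h₁, key, h₄, h₃, mul_add, h₂]
    noncomm_ring
  · rintro ⟨q, hq⟩ y hy z hz
    obtain ⟨q₁, h₁⟩ := D.exists_eq_mul_add_modr hf (y * z)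
    obtain ⟨q₂, h₂⟩ := D.exists_eq_mul_add_modr hf (y * D.pmul f z x)
    obtain ⟨q₃, h₃⟩ := D.exists_eq_mul_add_modr hf (z * x)
    change _ = _ + D.pmul f _ _ at h₁ h₂ h₃
    refine D.modr_eq hf ⟨y * q₃ + q₂ - q₁ * q, ?_⟩ (D.deg_modr_lt hf _)
    have h₄ : D.pmul f y z * x = y * (z * x) - q₁ * (f * x) := by
      rw [eq_sub_iff_add_eq, ← mul_assoc y, h₁]; noncomm_ring
    rw [h₄, h₃, mul_add, h₂, hq]
    noncomm_ring

end Division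

section CyclicModule

/-- The cyclic left module `R / Rf`. -/
def Cyc (_D : DiffPolyRing K δ R) (f : R) : Type := R ⧸ Submodule.span R {f}

variable (D : DiffPolyRing K δ R) (f : R)

instance : AddCommGroup (D.Cyc f) := inferInstanceAs (AddCommGroup (R ⧸ Submodule.span R {f}))

instance : Module R (D.Cyc f) := inferInstanceAs (Module R (R ⧸ Submodule.span R {f}))

instance : Module K (D.Cyc f) := Module.compHom _ D.i

lemma Cyc.smul_def (c : K) (v : D.Cyc f) : c • v = D.i c • v := rfl

/-- The projection `R → R / Rf`. -/
def toCyc : R →ₗ[R] D.Cyc f := (Submodule.span R {f}).mkQ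

lemma toCyc_surjective : Function.Surjective (D.toCyc f) := Submodule.mkQ_surjective _

lemma toCyc_eq_zero_iff {x : R} : D.toCyc f x = 0 ↔ ∃ q, x = q * f := by
  refine (Submodule.Quotient.mk_eq_zero _).trans (Submodule.mem_span_singleton.trans ?_)
  simp only [smul_eq_mul, eq_comm]

lemma smul_toCyc (c : K) (x : R) : c • D.toCyc f x = D.toCyc f (D.i c * x) :=
  ((D.toCyc f).map_smul (D.i c) x).symm

lemma mul_smul_toCyc (x y : R) : D.toCyc f (x * y) = x • D.toCyc f y :=
  (D.toCyc f).map_smul x y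

lemma t_smul_smul (c : K) (v : D.Cyc f) :
    D.t • c • v = c • D.t • v + δ.toFun c • v := by
  simp only [Cyc.smul_def, ← mul_smul, D.t_mul, add_smul]

variable {f} {m : ℕ}

lemma eq_of_toCyc_eq (hf : f ≠ 0) {x y : R} (hx : D.deg x < D.deg f)
    (hy : D.deg y < D.deg f) (h : D.toCyc f x = D.toCyc f y) : x = y := by
  rw [← sub_eq_zero, ← map_sub, toCyc_eq_zero_iff] at h
  obtain ⟨q, hq⟩ := h
  rw [← D.modr_eq_self hf hx]
  exact D.modr_eq hf ⟨q, by rw [← hq]; abel⟩ hy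

lemma toCyc_modr (hf : f ≠ 0) (x : R) : D.toCyc f (D.modr f x) = D.toCyc f x := by
  obtain ⟨q, hq⟩ := D.exists_eq_mul_add_modr hf x
  rw [eq_comm, ← sub_eq_zero, ← map_sub, toCyc_eq_zero_iff]
  exact ⟨q, by rw [sub_eq_iff_eq_add]; exact hq⟩

lemma eq_sum_of_deg_lt {x : R} (hx : D.deg x < (m : WithBot ℕ)) :
    x = ∑ a : Fin m, D.i (D.coeff x a) * D.t ^ (a : ℕ) := by
  conv_lhs => rw [D.repr' x]
  rw [Fin.sum_univ_eq_sum_range (fun a => D.i (D.coeff x a) * D.t ^ a) m]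
  refine Finsupp.sum_of_support_subset _ ?_ _ (by simp)
  intro n hn
  by_contra hle
  exact Finsupp.mem_support_iff.1 hn (D.deg_lt_iff.1 hx n (by simpa using hle))

/-- The powers `t^a`, `a < deg f`, form a `K`-basis of `R / Rf`. -/
noncomputable def cycBasis (hdeg : D.deg f = (m : WithBot ℕ)) :
    Module.Basis (Fin m) K (D.Cyc f) :=
  Module.Basis.mk (v := fun a : Fin m => D.toCyc f (D.t ^ (a : ℕ)))
    (by
      rw [Fintype.linearIndependent_iff]
      intro c hc b
      have hf := D.ne_zero_of_deg_eq hdeg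
      simp only [smul_toCyc, ← map_sum] at hc
      have hcoeff (n : ℕ) : D.coeff (∑ a : Fin m, D.i (c a) * D.t ^ (a : ℕ)) n =
          ∑ a : Fin m, if (a : ℕ) = n then c a else 0 := by
        simp only [coeff_sum, coeff_monomial, Finsupp.coe_finsetSum, Finset.sum_apply,
          Finsupp.single_apply]
      have h0 : ∑ a : Fin m, D.i (c a) * D.t ^ (a : ℕ) = 0 := by
        refine D.eq_of_toCyc_eq hf ?_ ?_ (by rw [hc, map_zero])
        · rw [hdeg, deg_lt_iff]
          intro n hn
          rw [hcoeff]
          exact Finset.sum_eq_zero fun a _ => if_neg (by omega)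
        · rw [hdeg, deg_zero]
          exact WithBot.bot_lt_coe m
      have := hcoeff b
      rw [h0, coeff_zero] at this
      simpa [Fin.val_inj] using this.symm)
    (by
      rintro v -
      have hf := D.ne_zero_of_deg_eq hdeg
      obtain ⟨x, rfl⟩ := D.toCyc_surjective f v
      have hx : D.deg (D.modr f x) < (m : WithBot ℕ) := hdeg ▸ D.deg_modr_lt hf x
      rw [← D.toCyc_modr hf, D.eq_sum_of_deg_lt hx, map_sum]
      refine Submodule.sum_mem _ fun a _ => ?_
      rw [← smul_toCyc]
      exact Submodule.smul_mem _ _ (Submodule.subset_span ⟨a, rfl⟩))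

lemma cycBasis_apply (hdeg : D.deg f = (m : WithBot ℕ)) (a : Fin m) :
    D.cycBasis hdeg a = D.toCyc f (D.t ^ (a : ℕ)) := by
  simp [cycBasis]

/-- Right multiplication by an element of the eigenring of `f`, as a `K`-linear endomorphism
of `R / Rf`. -/
def rightMul {g : R} (hg : ∃ q, f * g = q * f) : Module.End K (D.Cyc f) where
  toFun := (Submodule.span R {f}).liftQ ((D.toCyc f).comp (LinearMap.toSpanSingleton R R g))
    (by
      rw [Submodule.span_singleton_le_iff_mem, LinearMap.mem_ker]
      exact (D.toCyc_eq_zero_iff f).2 hg)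
  map_add' := map_add _
  map_smul' c v := map_smul _ (D.i c) v

lemma rightMul_toCyc {g : R} (hg : ∃ q, f * g = q * f) (x : R) :
    D.rightMul hg (D.toCyc f x) = D.toCyc f (x * g) := rfl

lemma rightMul_t_smul {g : R} (hg : ∃ q, f * g = q * f) (v : D.Cyc f) :
    D.rightMul hg (D.t • v) = D.t • D.rightMul hg v := by
  obtain ⟨x, rfl⟩ := D.toCyc_surjective f v
  rw [← mul_smul_toCyc, rightMul_toCyc, rightMul_toCyc, ← mul_smul_toCyc, mul_assoc]

variable {ι : Type} [Fintype ι]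

lemma sum_deriv_smul_eq_zero {ψ : Module.End K (D.Cyc f)} {w : ι → Module.End K (D.Cyc f)}
    (hψ : ∀ v, ψ (D.t • v) = D.t • ψ v) (hw : ∀ k v, w k (D.t • v) = D.t • w k v)
    {l : ι → K} (h : ∑ k, l k • w k = ψ) : ∑ k, δ.toFun (l k) • w k = 0 := by
  ext v
  have h1 := hψ v
  rw [← h] at h1
  simp only [LinearMap.sum_apply, LinearMap.smul_apply, hw, Finset.smul_sum, t_smul_smul,
    Finset.sum_add_distrib] at h1 ⊢
  simpa using h1

lemma eq_zero_of_commutes (hdeg : D.deg f = (m : WithBot ℕ)) {ψ : Module.End K (D.Cyc f)}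
    (hψ : ∀ v, ψ (D.t • v) = D.t • ψ v) (h1 : ψ (D.toCyc f 1) = 0) : ψ = 0 := by
  have hpow (n : ℕ) : ψ (D.toCyc f (D.t ^ n)) = 0 := by
    induction n with
    | zero => simpa using h1
    | succ n ih => rw [pow_succ', mul_smul_toCyc, hψ, ih, smul_zero]
  exact (D.cycBasis hdeg).ext fun a => by rw [cycBasis_apply, hpow, LinearMap.zero_apply]

lemma toCyc_sum_smul {F : Type} [Field F] [Algebra F K] (c : ι → F) (g : ι → D.Rlt m) :
    D.toCyc f ((∑ k, c k • g k : D.Rlt m) : R) =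
      ∑ k, algebraMap F K (c k) • D.toCyc f (g k) := by
  rw [AddSubgroup.val_finsetSum, map_sum]
  simp only [smul_coe, smul_toCyc]

lemma sum_smul_rightMul_one {g : ι → R} (hg : ∀ k, ∃ q, f * g k = q * f) (l : ι → K) :
    (∑ k, l k • D.rightMul (hg k)) (D.toCyc f 1) = ∑ k, l k • D.toCyc f (g k) := by
  simp [rightMul_toCyc]

/-- Elements of the eigenring which are linearly independent over the constants yield
`K`-linearly independent endomorphisms of `R / Rf`. -/
lemma linearIndependent_rightMul {F : Type} [Field F] [Algebra F K] (hF : δ.HasConstants F)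
    (hdeg : D.deg f = (m : WithBot ℕ)) {g : ι → D.Rlt m}
    (hg : ∀ k, ∃ q, f * (g k : R) = q * f) (hli : LinearIndependent F g) :
    LinearIndependent K fun k => D.rightMul (hg k) := by
  refine δ.linearIndependent_of_constants _ (fun l hl => ?_) fun l hl h => ?_
  · exact D.sum_deriv_smul_eq_zero (by simp) (fun k => D.rightMul_t_smul (hg k)) hl
  · choose c hc using fun k => (hF (l k)).1 (hl k)
    have h1 := D.sum_smul_rightMul_one hg l
    rw [h, LinearMap.zero_apply] at h1
    simp only [← hc] at h1
    rw [← toCyc_sum_smul] at h1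
    have h0 : (∑ k, c k • g k : D.Rlt m) = 0 := Subtype.ext <|
      D.eq_of_toCyc_eq (D.ne_zero_of_deg_eq hdeg) (hdeg ▸ (∑ k, c k • g k : D.Rlt m).2)
        (hdeg ▸ (0 : D.Rlt m).2) (h1.symm.trans (map_zero _).symm)
    intro k
    rw [← hc, Fintype.linearIndependent_iff.1 hli c h0 k, map_zero]

lemma finrank_end_cyc (hdeg : D.deg f = (m : WithBot ℕ)) :
    Module.finrank K (Module.End K (D.Cyc f)) = m ^ 2 := by
  have := Module.Finite.of_basis (D.cycBasis hdeg)
  rw [Module.finrank_linearMap, Module.finrank_eq_card_basis (D.cycBasis hdeg),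
    Fintype.card_fin, sq]

end CyclicModule

section Presentation

variable {F : Type} [Field F] [Algebra F K] (D : DiffPolyRing K δ R) {f : R} {m : ℕ}

lemma RightNucPresents.exists_linearMap (hdeg : D.deg f = (m : WithBot ℕ)) {B : Type} [Ring B]
    [Algebra F B] (h : D.RightNucPresents F f m B) :
    ∃ e : B →ₗ[F] D.Rlt m, Function.Injective e ∧
      (∀ x : D.Rlt m, (∃ b, e b = x) ↔ (x : R) ∈ D.nucr f m) ∧
      (∀ x y, (e (x * y) : R) = D.pmul f (e x) (e y)) ∧
      ∀ c : F, (e (algebraMap F B c) : R) = D.i (algebraMap F K c) := by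
  obtain ⟨φ, hadd, hmul, halg⟩ := h
  refine ⟨⟨⟨fun b => ⟨φ b, (φ b).2.1⟩, fun x y => Subtype.ext (hadd x y)⟩, fun c x => ?_⟩,
    fun x y hxy => ?_, fun x => ⟨?_, fun hx => ?_⟩, hmul, halg⟩
  · refine Subtype.ext ?_
    rw [RingHom.id_apply, smul_coe]
    change (φ (c • x) : R) = _
    rw [Algebra.smul_def, hmul, halg]
    exact D.modr_eq_self (D.ne_zero_of_deg_eq hdeg)
      (hdeg ▸ D.deg_i_mul_lt _ (φ x).2.1)
  · exact φ.injective (Subtype.ext (congrArg (fun z : D.Rlt m => (z : R)) hxy))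
  · rintro ⟨b, rfl⟩
    exact (φ b).2
  · exact ⟨φ.symm ⟨x, hx⟩, Subtype.ext (by simp)⟩

end Presentation

section BaseChange

variable {L R' : Type} [Field L] [Ring R'] [Algebra K L] {δL : Der L}
  (D : DiffPolyRing K δ R) (D' : DiffPolyRing L δL R') (j : R →+* R')
  (hji : ∀ a : K, j (D.i a) = D'.i (algebraMap K L a)) (hjt : j D.t = D'.t)

include hji hjt in
lemma coeff_map (x : R) :
    D'.coeff (j x) = (D.coeff x).mapRange (algebraMap K L) (map_zero _) := by
  refine (D'.coeff_unique _ _ ?_).symm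
  rw [Finsupp.sum_mapRange_index (by simp)]
  conv_lhs => rw [D.repr' x, Finsupp.sum, map_sum]
  simp [Finsupp.sum, hji, hjt]

include hji hjt in
lemma deg_map (x : R) : D'.deg (j x) = D.deg x := by
  unfold deg
  rw [D.coeff_map D' j hji hjt,
    Finsupp.support_mapRange_of_injective _ _ (algebraMap K L).injective]

include hji hjt in
lemma modr_map {f : R} (hf : f ≠ 0) (x : R) :
    D'.modr (j f) (j x) = j (D.modr f x) := by
  have hjf : j f ≠ 0 := by
    intro h
    have hd := D.deg_map D' j hji hjt f
    rw [h, deg_zero, ← D.deg_zero] at hd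
    have := D.deg_modr_lt hf 0
    rw [← hd, deg_zero] at this
    exact not_lt_bot this
  refine D'.modr_eq hjf ?_ ?_
  · obtain ⟨q, hq⟩ := D.exists_eq_mul_add_modr hf x
    exact ⟨j q, by rw [← map_mul, ← map_add, ← hq]⟩
  · rw [D.deg_map D' j hji hjt, D.deg_map D' j hji hjt]
    exact D.deg_modr_lt hf x

/-- The map induced by `R → R'` on differential polynomials of degree `< m`. -/
def mapRlt (m : ℕ) (x : D.Rlt m) : D'.Rlt m :=
  ⟨j x, (D.deg_map D' j hji hjt x).trans_lt x.2⟩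

/-- The semilinear map `R / Rf → R' / R'f` induced by `R → R'`. -/
def cycMap (f : R) : D.Cyc f →ₛₗ[j] D'.Cyc (j f) :=
  (Submodule.span R {f}).liftQ
    { toFun := fun x => D'.toCyc (j f) (j x)
      map_add' := fun x y => by rw [map_add, map_add]
      map_smul' := fun x y => by rw [smul_eq_mul, map_mul, mul_smul_toCyc] }
    (by
      rw [Submodule.span_singleton_le_iff_mem, LinearMap.mem_ker]
      exact (D'.toCyc_eq_zero_iff _).2 ⟨1, (one_mul _).symm⟩)

omit [Algebra K L] in
lemma cycMap_toCyc (f x : R) :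
    D.cycMap D' j f (D.toCyc f x) = D'.toCyc (j f) (j x) := rfl

include hji in
lemma cycMap_smul (f : R) (c : K) (v : D.Cyc f) :
    D.cycMap D' j f (c • v) = algebraMap K L c • D.cycMap D' j f v := by
  rw [Cyc.smul_def, Cyc.smul_def, ← hji]
  exact (D.cycMap D' j f).map_smulₛₗ _ _

omit [Algebra K L] in
lemma cycMap_rightMul {f g : R} (hg : ∃ q, f * g = q * f) (hg' : ∃ q, j f * j g = q * j f)
    (v : D.Cyc f) :
    D.cycMap D' j f (D.rightMul hg v) = D'.rightMul hg' (D.cycMap D' j f v) := by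
  obtain ⟨x, rfl⟩ := D.toCyc_surjective f v
  rw [rightMul_toCyc, cycMap_toCyc, cycMap_toCyc, rightMul_toCyc, map_mul]

variable {f : R} {m : ℕ} {ι : Type} [Fintype ι]

include hji hjt in
/-- If right multiplications by eigenring elements span `End_K (R / Rf)`, then their images
span `End_L (R' / R'f)`. -/
lemma span_rightMul_map (hdeg : D.deg f = (m : WithBot ℕ)) {g : ι → R}
    (hg : ∀ k, ∃ q, f * g k = q * f) (hg' : ∀ k, ∃ q, j f * j (g k) = q * j f)
    (hspan : Submodule.span K (Set.range fun k => D.rightMul (hg k)) = ⊤) :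
    Submodule.span L (Set.range fun k => D'.rightMul (hg' k)) = ⊤ := by
  have hdeg' : D'.deg (j f) = (m : WithBot ℕ) := (D.deg_map D' j hji hjt f).trans hdeg
  set b := D.cycBasis hdeg
  set b' := D'.cycBasis hdeg'
  have hb (a : Fin m) : D.cycMap D' j f (b a) = b' a := by
    rw [cycBasis_apply, cycBasis_apply, cycMap_toCyc, map_pow, hjt]
  rw [eq_top_iff, ← (b'.linearMap b').span_eq, Submodule.span_le]
  rintro _ ⟨p, rfl⟩
  have hp : b.linearMap b p ∈ Submodule.span K (Set.range fun k => D.rightMul (hg k)) :=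
    hspan ▸ Submodule.mem_top
  obtain ⟨c, hc⟩ := (Submodule.mem_span_range_iff_exists_fun K).1 hp
  refine (Submodule.mem_span_range_iff_exists_fun L).2
    ⟨fun k => algebraMap K L (c k), b'.ext fun a => ?_⟩
  have h := congrArg (D.cycMap D' j f) (LinearMap.congr_fun hc (b a))
  simp only [LinearMap.sum_apply, LinearMap.smul_apply, map_sum, D.cycMap_smul D' j hji,
    D.cycMap_rightMul D' j (hg _) (hg' _), hb, Module.Basis.linearMap_apply_apply] at h
  simp only [LinearMap.sum_apply, LinearMap.smul_apply, h, Module.Basis.linearMap_apply_apply]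
  split_ifs
  · rw [hb]
  · rw [map_zero]

include hji hjt in
lemma mem_nucr_map (hm : 2 ≤ m) (hdeg : D.deg f = (m : WithBot ℕ)) {x : R}
    (hx : x ∈ D.nucr f m) : j x ∈ D'.nucr (j f) m := by
  rw [D.mem_nucr_iff hm hdeg] at hx
  rw [D'.mem_nucr_iff hm ((D.deg_map D' j hji hjt f).trans hdeg), D.deg_map D' j hji hjt]
  obtain ⟨hx, q, hq⟩ := hx
  exact ⟨hx, j q, by rw [← map_mul, hq, map_mul]⟩

/-- A basis over the constants of a right nucleus of maximal dimension `m ^ 2` remains a basis,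
over the new constants, of the right nucleus after any extension of differential fields. -/
theorem nucr_map_basis {F C : Type} [Field F] [Field C] [Algebra F K] [Algebra C L]
    (hF : δ.HasConstants F) (hC : δL.HasConstants C) (hm : 2 ≤ m)
    (hdeg : D.deg f = (m : WithBot ℕ)) {g : ι → D.Rlt m} (hg : ∀ k, (g k : R) ∈ D.nucr f m)
    (hli : LinearIndependent F g) (hcard : Fintype.card ι = m ^ 2) :
    LinearIndependent C (fun k => D.mapRlt D' j hji hjt m (g k)) ∧
      ∀ x : D'.Rlt m, (x : R') ∈ D'.nucr (j f) m →
        x ∈ Submodule.span C (Set.range fun k => D.mapRlt D' j hji hjt m (g k)) := by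
  have hdeg' : D'.deg (j f) = (m : WithBot ℕ) := (D.deg_map D' j hji hjt f).trans hdeg
  have heig (k : ι) := ((D.mem_nucr_iff hm hdeg).1 (hg k)).2
  have heig' (k : ι) : ∃ q, j f * (D.mapRlt D' j hji hjt m (g k) : R') = q * j f :=
    ((D'.mem_nucr_iff hm hdeg').1 (D.mem_nucr_map D' j hji hjt hm hdeg (hg k))).2
  have := Module.Finite.of_basis (D.cycBasis hdeg)
  have := Module.Finite.of_basis (D'.cycBasis hdeg')
  have hspan' : Submodule.span L (Set.range fun k => D'.rightMul (heig' k)) = ⊤ :=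
    D.span_rightMul_map D' j hji hjt hdeg heig heig'
      ((D.linearIndependent_rightMul hF hdeg heig hli).span_eq_top_of_card_eq_finrank'
        (hcard.trans (D.finrank_end_cyc hdeg).symm))
  have hli' : LinearIndependent L fun k => D'.rightMul (heig' k) :=
    linearIndependent_of_top_le_span_of_card_eq_finrank hspan'.ge
      (hcard.trans (D'.finrank_end_cyc hdeg').symm)
  have hcomm (k : ι) := D'.rightMul_t_smul (heig' k)
  constructor
  · rw [Fintype.linearIndependent_iff]
    intro c hc k
    have hψ : ∑ k, algebraMap C L (c k) • D'.rightMul (heig' k) = 0 := by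
      refine D'.eq_zero_of_commutes hdeg' (fun v => ?_) ?_
      · simp only [LinearMap.sum_apply, LinearMap.smul_apply, hcomm, Finset.smul_sum,
          t_smul_smul, (hC _).2 ⟨_, rfl⟩, zero_smul, add_zero]
      · rw [sum_smul_rightMul_one, ← toCyc_sum_smul, hc]
        exact map_zero _
    exact (algebraMap C L).injective
      ((Fintype.linearIndependent_iff.1 hli' _ hψ k).trans (map_zero _).symm)
  · intro x hx
    have hxe := ((D'.mem_nucr_iff hm hdeg').1 hx).2
    obtain ⟨l, hl⟩ := (Submodule.mem_span_range_iff_exists_fun L).1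
      (hspan' ▸ Submodule.mem_top : D'.rightMul hxe ∈ _)
    have hconst := Fintype.linearIndependent_iff.1 hli' _
      (D'.sum_deriv_smul_eq_zero (D'.rightMul_t_smul hxe) hcomm hl)
    choose c hc using fun k => (hC (l k)).1 (hconst k)
    refine (Submodule.mem_span_range_iff_exists_fun C).2 ⟨c, Subtype.ext ?_⟩
    refine D'.eq_of_toCyc_eq (D'.ne_zero_of_deg_eq hdeg')
      (hdeg' ▸ (∑ k, c k • D.mapRlt D' j hji hjt m (g k) : D'.Rlt m).2) (hdeg' ▸ x.2) ?_
    have h1 := LinearMap.congr_fun hl (D'.toCyc (j f) 1)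
    rw [sum_smul_rightMul_one, rightMul_toCyc, one_mul] at h1
    rw [toCyc_sum_smul, ← h1]
    simp only [hc]

end BaseChange

end DiffPolyRing

/-- A basis of the image of an injective linear map pulls back to a basis of the source. -/
lemma exists_basis_of_injective {F B M ι : Type} [Field F] [AddCommGroup B] [Module F B]
    [AddCommGroup M] [Module F M] {e : B →ₗ[F] M} (he : Function.Injective e) {g : ι → M}
    (hg : ∀ k, ∃ b, e b = g k) (hli : LinearIndependent F g)
    (hspan : ∀ b, e b ∈ Submodule.span F (Set.range g)) :
    ∃ v : Module.Basis ι F B, ∀ k, e (v k) = g k := by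
  choose b hb using hg
  have hcomp : e ∘ b = g := funext hb
  refine ⟨Module.Basis.mk (v := b) (LinearIndependent.of_comp e (hcomp ▸ hli)) ?_,
    fun k => by rw [Module.Basis.mk_apply, hb]⟩
  intro x _
  have hx := hspan x
  rw [← hcomp, Set.range_comp, ← Submodule.map_span] at hx
  obtain ⟨y, hy, hyx⟩ := hx
  exact he hyx ▸ hy

/-- Let `L/K` be a field extension to which `δ` extends, with constant
field `C`, such that `L = K·C` is a constant extension of `K` (char. zero).  If
`f ∈ K[t;δ]` is an `A`-polynomial of degree `m`, then `f` viewed in `L[t;δ]` is an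
`A`-polynomial and `Nuc_r(L[t;δ]/L[t;δ]f) ≅ Nuc_r(K[t;δ]/K[t;δ]f) ⊗_F C`. -/
theorem statement_15 (F K C L : Type) [Field F] [Field K] [Field C] [Field L]
    [CharZero K] [Algebra F K] [Algebra F C] [Algebra F L] [Algebra K L] [Algebra C L]
    [IsScalarTower F K L] [IsScalarTower F C L]
    (δK : Der K) (δL : Der L) (hFK : δK.HasConstants F) (hCL : δL.HasConstants C)
    (hext : ∀ a : K, δL.toFun (algebraMap K L a) = algebraMap K L (δK.toFun a))
    (hcomp : ∀ x : L, x ∈ Subfield.closure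
      (Set.range (algebraMap K L) ∪ Set.range (algebraMap C L)))
    (R R' : Type) [Ring R] [Ring R']
    (D : DiffPolyRing K δK R) (D' : DiffPolyRing L δL R')
    (j : R →+* R') (hji : ∀ a : K, j (D.i a) = D'.i (algebraMap K L a))
    (hjt : j D.t = D'.t)
    (f : R) (m : ℕ) (hm : 2 ≤ m) (hdeg : D.deg f = (m : WithBot ℕ))
    (hA : D.IsAPoly F f m) :
    D'.IsAPoly C (j f) m ∧
    ∀ (B : Type) (_ : Ring B) (_ : Algebra F B), D.RightNucPresents F f m B →
      ∀ (B' : Type) (_ : Ring B') (_ : Algebra C B'), D'.RightNucPresents C (j f) m B' →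
        Nonempty (B' ≃ₐ[C] (C ⊗[F] B)) := by
  classical
  obtain ⟨s, hs, hcard, hli, hspan⟩ := hA
  have hcard' : Fintype.card (s : Set (D.Rlt m)) = m ^ 2 := by simpa using hcard
  have hg (k : (s : Set (D.Rlt m))) : ((k : D.Rlt m) : R) ∈ D.nucr f m := hs k.2
  have hdeg' : D'.deg (j f) = (m : WithBot ℕ) :=
    (D.deg_map D' j hji hjt f).trans hdeg
  obtain ⟨hli', hspan'⟩ := D.nucr_map_basis D' j hji hjt hFK hCL hm hdeg hg hli hcard'
  set g' := fun k : (s : Set (D.Rlt m)) => D.mapRlt D' j hji hjt m k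
  have hg' (k) : (g' k : R') ∈ D'.nucr (j f) m := D.mem_nucr_map D' j hji hjt hm hdeg (hg k)
  refine ⟨⟨Finset.univ.image g', ?_, ?_, ?_, ?_⟩, ?_⟩
  · rw [Finset.coe_image, Finset.coe_univ, Set.image_univ]
    rintro _ ⟨k, rfl⟩
    exact hg' k
  · rw [Finset.card_image_of_injective _ hli'.injective, Finset.card_univ, hcard']
  · rw [Finset.coe_image, Finset.coe_univ, Set.image_univ]
    exact hli'.linearIndepOn_id
  · rw [Finset.coe_image, Finset.coe_univ, Set.image_univ]
    exact hspan'
  · intro B _ _ hB B' _ _ hB'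
    obtain ⟨e, he, hrange, hmul, halg⟩ := hB.exists_linearMap D hdeg
    obtain ⟨e', he', hrange', hmul', halg'⟩ := hB'.exists_linearMap D' hdeg'
    obtain ⟨v, hv⟩ := exists_basis_of_injective he (fun k => (hrange _).2 (hg k)) hli fun b => by
      rw [Subtype.range_coe]
      exact hspan ((hrange _).1 ⟨b, rfl⟩)
    obtain ⟨v', hv'⟩ := exists_basis_of_injective he' (fun k => (hrange' _).2 (hg' k)) hli'
      fun b => hspan' _ ((hrange' _).1 ⟨b, rfl⟩)
    have hθ (b : B) : ∃ b' : B', (e' b' : R') = j (e b) := by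
      obtain ⟨b', h⟩ := (hrange' (D.mapRlt D' j hji hjt m (e b))).2
        (D.mem_nucr_map D' j hji hjt hm hdeg ((hrange _).1 ⟨b, rfl⟩))
      exact ⟨b', congrArg Subtype.val h⟩
    choose θ hθ using hθ
    have hinj {x y : B'} (h : (e' x : R') = e' y) : x = y := he' (Subtype.ext h)
    let : Algebra F B' := Algebra.compHom B' (algebraMap F C)
    have : IsScalarTower F C B' := IsScalarTower.of_algebraMap_eq fun _ => rfl
    have hθalg (c : F) : θ (algebraMap F B c) = algebraMap F B' c := hinj <| by
      rw [hθ, halg, hji, IsScalarTower.algebraMap_apply F C B', halg',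
        ← IsScalarTower.algebraMap_apply, ← IsScalarTower.algebraMap_apply]
    let Θ : B →ₐ[F] B' :=
      { toFun := θ
        map_one' := by simpa using hθalg 1
        map_zero' := by simpa using hθalg 0
        map_add' := fun x y => hinj <| by simp [hθ]
        map_mul' := fun x y => hinj <| by
          rw [hθ, hmul, hmul', hθ, hθ, DiffPolyRing.pmul, DiffPolyRing.pmul, ← map_mul,
            D.modr_map D' j hji hjt (D.ne_zero_of_deg_eq hdeg)]
        commutes' := hθalg }
    let Φ : C ⊗[F] B →ₐ[C] B' := Algebra.TensorProduct.lift (Algebra.ofId C B') Θ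
      fun x y => Algebra.commutes x (Θ y)
    let E := (v.baseChange C).equiv v' (Equiv.refl (s : Set (D.Rlt m)))
    have hΦ : Φ.toLinearMap = E.toLinearMap := by
      refine (v.baseChange C).ext fun k => hinj ?_
      have h : Φ (v.baseChange C k) = θ (v k) := by
        rw [Module.Basis.baseChange_apply]
        exact (Algebra.TensorProduct.lift_tmul _ _ _ _ _).trans (by rw [map_one, one_mul]; rfl)
      rw [AlgHom.toLinearMap_apply, h, LinearEquiv.coe_coe, Module.Basis.equiv_apply,
        Equiv.refl_apply, hv', hθ, hv]
      rfl
    have hbij : Function.Bijective Φ := by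
      rw [show (Φ : C ⊗[F] B → B') = E from congrArg DFunLike.coe hΦ]
      exact E.bijective
    exact ⟨(AlgEquiv.ofBijective Φ hbij).symm⟩
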